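/- The position P0 (with Alfred to move) is drawn: both Alfred and Betty have drawing strategies from P0. -/

import Mathlib

/-!
Formalization of Philosophers' Phutball on an `m × n` board (`m` rows, `n` columns).
Points are pairs `(column, row)` of integers, with columns `1, …, n` (a, b, c, …)
and rows `1, …, m` (bottom to top).  Player `true` is Alfred (first player, aims
for the top row `m`); player `false` is Betty (aims for the bottom row `1`).
-/

/-- A player: `true` is Alfred, `false` is Betty. -/
abbrev Player := Bool

/-- A Phutball position: the ball's point `(column, row)`, the finite set of
chaps, and the player whose turn it is. -/
structure PState where
  ball : ℤ × ℤ
  chaps : Finset (ℤ × ℤ)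
  turn : Player
deriving DecidableEq

/-- The eight horizontal, vertical and diagonal directions. -/
def dirs : Finset (ℤ × ℤ) :=
  {(1, 0), (1, 1), (0, 1), (-1, 1), (-1, 0), (-1, -1), (0, -1), (1, -1)}

/-- The point reached from `b` after `i` steps in direction `d`. -/
def ray (b d : ℤ × ℤ) (i : ℤ) : ℤ × ℤ := (b.1 + i * d.1, b.2 + i * d.2)

/-- A point is on the `m × n` board. -/
def OnBoard (m n : ℤ) (p : ℤ × ℤ) : Prop :=
  1 ≤ p.1 ∧ p.1 ≤ n ∧ 1 ≤ p.2 ∧ p.2 ≤ m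

/-- A single hop on a board with `n` columns: the ball at `b` moves in one of the
eight directions `d` over a contiguous nonempty line of `k` chaps, landing on the
first point beyond them that carries no chap; the jumped-over chaps are removed.
The landing point must not lie onto or past the sidelines (outside columns
`1, …, n`), but it may lie past the top or bottom row. -/
def Hop (n : ℤ) (b : ℤ × ℤ) (c : Finset (ℤ × ℤ)) (b' : ℤ × ℤ) (c' : Finset (ℤ × ℤ)) : Prop :=
  ∃ d ∈ dirs, ∃ k : ℕ, 1 ≤ k ∧
    (∀ i : ℕ, 1 ≤ i → i ≤ k → ray b d i ∈ c) ∧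
    ray b d (k + 1) ∉ c ∧
    1 ≤ (ray b d (k + 1)).1 ∧ (ray b d (k + 1)).1 ≤ n ∧
    b' = ray b d (k + 1) ∧
    c' = c \ Finset.image (fun i : ℕ => ray b d i) (Finset.Icc 1 k)

/-- A jump is a nonempty sequence of hops (the player may stop after any hop,
and the removed chaps cannot be re-used by later hops of the same jump).  The
jump can continue after a hop only if the ball has not been carried past the top
or bottom row (which would end the game immediately). -/
inductive Jump (m n : ℤ) : ℤ × ℤ → Finset (ℤ × ℤ) → ℤ × ℤ → Finset (ℤ × ℤ) → Prop
  | single {b c b' c'} : Hop n b c b' c' → Jump m n b c b' c'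
  | cons {b c b₁ c₁ b' c'} : Hop n b c b₁ c₁ → 1 ≤ b₁.2 → b₁.2 ≤ m →
      Jump m n b₁ c₁ b' c' → Jump m n b c b' c'

/-- The winner, if any, of a position (evaluated between turns): Alfred wins if
the ball rests on the top row `m` or has been carried past it; Betty wins if the
ball rests on the bottom row `1` or has been carried past it. -/
def winner (m : ℤ) (s : PState) : Option Player :=
  if m ≤ s.ball.2 then some true else if s.ball.2 ≤ 1 then some false else none

/-- A single legal move on the `m × n` board: the player to move either places a
chap on a vacant on-board point, or moves the ball by a jump; the turn passes to
the other player. -/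
def MoveRel (m n : ℤ) (s t : PState) : Prop :=
  t.turn = !s.turn ∧
    ((∃ p, OnBoard m n p ∧ p ∉ s.chaps ∧ p ≠ s.ball ∧
        t.ball = s.ball ∧ t.chaps = insert p s.chaps) ∨
      Jump m n s.ball s.chaps t.ball t.chaps)

/-- An infinite record of play: while the game is not over and a legal move
exists, a legal move is made; otherwise the position is frozen forever. -/
def IsPlay (m n : ℤ) (f : ℕ → PState) : Prop :=
  ∀ k,
    (winner m (f k) = none ∧ (∃ t, MoveRel m n (f k) t) ∧ MoveRel m n (f k) (f (k + 1))) ∨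
    ((winner m (f k) ≠ none ∨ ¬ ∃ t, MoveRel m n (f k) t) ∧ f (k + 1) = f k)

/-- A strategy for player `p` that always proposes a legal move whenever the game
is not over, it is `p`'s turn, and some legal move exists. -/
def LegalStrategy (m n : ℤ) (p : Player) (σ : PState → PState) : Prop :=
  ∀ s, s.turn = p → winner m s = none → (∃ t, MoveRel m n s t) → MoveRel m n s (σ s)

/-- The play `f` follows the strategy `σ` of player `p`. -/
def Follows (m n : ℤ) (p : Player) (σ : PState → PState) (f : ℕ → PState) : Prop :=
  ∀ k, (f k).turn = p → winner m (f k) = none → (∃ t, MoveRel m n (f k) t) →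
    f (k + 1) = σ (f k)

/-- Player `p` has a winning strategy from `s₀` on the `m × n` board: a legal
strategy guaranteeing that, against every play of the opponent, `p` wins after
finitely many moves. -/
def WinsFrom (m n : ℤ) (p : Player) (s₀ : PState) : Prop :=
  ∃ σ, LegalStrategy m n p σ ∧
    ∀ f, IsPlay m n f → f 0 = s₀ → Follows m n p σ f → ∃ k, winner m (f k) = some p

/-- Player `p` has a drawing strategy from `s₀` on the `m × n` board: a legal
strategy guaranteeing that the opponent never wins (play may continue forever). -/
def DrawsFrom (m n : ℤ) (p : Player) (s₀ : PState) : Prop :=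
  ∃ σ, LegalStrategy m n p σ ∧
    ∀ f, IsPlay m n f → f 0 = s₀ → Follows m n p σ f → ∀ k, winner m (f k) ≠ some (!p)

/-- A position is drawn if both players have drawing strategies from it. -/
def Drawn (m n : ℤ) (s : PState) : Prop :=
  DrawsFrom m n true s ∧ DrawsFrom m n false s

/-- The 24 chaps of the position `P0` on the 12 × 10 board:
c1, c2, c5, c7, c9, c10, c11, c12, d6, e4, e11, e12, f1, f2, f9, g7,
h1, h2, h3, h4, h6, h8, h11, h12. -/
def P0chaps : Finset (ℤ × ℤ) :=
  {(3, 1), (3, 2), (3, 5), (3, 7), (3, 9), (3, 10), (3, 11), (3, 12), (4, 6), (5, 4), (5, 11), (5, 12), (6, 1), (6, 2), (6, 9), (7, 7), (8, 1), (8, 2), (8, 3), (8, 4), (8, 6), (8, 8), (8, 11), (8, 12)}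

/-- The position `P0`: ball at a2 = (1, 2), the 24 chaps above, Alfred to move. -/
def P0 : PState := ⟨(1, 2), P0chaps, true⟩

/-! ### Invariants give drawing strategies -/

/-- A player draws from a position in a set of positions that contains no win for the opponent,
that this player can always stay inside, and that the opponent cannot leave. -/
theorem drawsFrom_of_invariant {m n : ℤ} {p : Player} {s₀ : PState} (I : PState → Prop)
    (start : I s₀) (not_lost : ∀ s, I s → winner m s ≠ some (!p))
    (own : ∀ s, I s → s.turn = p → winner m s = none → ∃ t, MoveRel m n s t ∧ I t)
    (opp : ∀ s t, I s → s.turn = !p → winner m s = none → MoveRel m n s t → I t) :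
    DrawsFrom m n p s₀ := by
  classical
  have key : ∀ s, ∃ t, (I s → s.turn = p → winner m s = none → MoveRel m n s t ∧ I t) ∧
      ((∃ t, MoveRel m n s t) → MoveRel m n s t) := by
    intro s
    by_cases h : I s ∧ s.turn = p ∧ winner m s = none
    · obtain ⟨t, ht, hI⟩ := own s h.1 h.2.1 h.2.2
      exact ⟨t, fun _ _ _ => ⟨ht, hI⟩, fun _ => ht⟩
    · by_cases h' : ∃ t, MoveRel m n s t
      · obtain ⟨t, ht⟩ := h'
        exact ⟨t, fun h₁ h₂ h₃ => absurd ⟨h₁, h₂, h₃⟩ h, fun _ => ht⟩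
      · exact ⟨s, fun h₁ h₂ h₃ => absurd ⟨h₁, h₂, h₃⟩ h, fun h'' => absurd h'' h'⟩
  choose σ hσ hlegal using key
  refine ⟨σ, fun s _ _ h => hlegal s h, fun f hf h0 hfol k => not_lost _ ?_⟩
  induction k with
  | zero => exact h0 ▸ start
  | succ k ih =>
    rcases hf k with ⟨hw, hex, hm⟩ | ⟨_, he⟩
    · by_cases ht : (f k).turn = p
      · rw [hfol k ht hw hex]
        exact (hσ _ ih ht hw).2
      · exact opp _ _ ih (by revert ht; cases (f k).turn <;> cases p <;> simp) hw hm
    · exact he ▸ ih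

/-! ### The half-turn symmetry of the board -/

/-- The half turn of the 12 × 10 board. -/
def rot (p : ℤ × ℤ) : ℤ × ℤ := (11 - p.1, 13 - p.2)

@[simp] theorem rot_rot (p : ℤ × ℤ) : rot (rot p) = p := by simp [rot]

theorem rot_injective : Function.Injective rot := Function.LeftInverse.injective rot_rot

theorem rot_ray (b d : ℤ × ℤ) (i : ℤ) : rot (ray b d i) = ray (rot b) (-d) i := by
  ext <;> simp [rot, ray] <;> ring

@[simp] theorem rot_mem_image {p : ℤ × ℤ} {c : Finset (ℤ × ℤ)} :
    rot p ∈ c.image rot ↔ p ∈ c :=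
  rot_injective.mem_finset_image

/-- The half turn of a position, which exchanges the roles of the players. -/
def PState.rot (s : PState) : PState := ⟨_root_.rot s.ball, s.chaps.image _root_.rot, !s.turn⟩

@[simp] theorem PState.rot_rot (s : PState) : s.rot.rot = s := by
  cases s
  simp [PState.rot, Finset.image_image, Function.comp_def]

theorem neg_mem_dirs {d : ℤ × ℤ} (h : d ∈ dirs) : -d ∈ dirs := by
  revert d
  decide

theorem Hop.rot {b b' : ℤ × ℤ} {c c' : Finset (ℤ × ℤ)} (h : Hop 10 b c b' c') :
    Hop 10 (rot b) (c.image rot) (rot b') (c'.image rot) := by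
  obtain ⟨d, hd, k, hk, hin, hout, h1, h2, rfl, rfl⟩ := h
  refine ⟨-d, neg_mem_dirs hd, k, hk, fun i hi hik => ?_, ?_, ?_, ?_, rot_ray .., ?_⟩
  · rw [← rot_ray, rot_mem_image]
    exact hin i hi hik
  · rwa [← rot_ray, rot_mem_image]
  · rw [← rot_ray]
    simp only [_root_.rot]
    linarith
  · rw [← rot_ray]
    simp only [_root_.rot]
    linarith
  · rw [Finset.image_sdiff _ _ rot_injective, Finset.image_image]
    congr 2
    funext i
    exact rot_ray ..

theorem Jump.rot {b b' : ℤ × ℤ} {c c' : Finset (ℤ × ℤ)} (h : Jump 12 10 b c b' c') :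
    Jump 12 10 (rot b) (c.image rot) (rot b') (c'.image rot) := by
  induction h with
  | single h => exact .single h.rot
  | cons h h1 h2 _ ih =>
    refine .cons h.rot ?_ ?_ ih <;> simp only [_root_.rot] <;> linarith

theorem MoveRel.rot {s t : PState} (h : MoveRel 12 10 s t) : MoveRel 12 10 s.rot t.rot := by
  obtain ⟨ht, ⟨p, ⟨h1, h2, h3, h4⟩, hp, hb, hball, hchaps⟩ | hj⟩ := h
  · refine ⟨by simp [PState.rot, ht], .inl ⟨_root_.rot p, ?_, ?_, ?_, ?_, ?_⟩⟩
    · simp only [OnBoard, _root_.rot]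
      omega
    · exact fun h => hp (rot_mem_image.1 h)
    · exact fun h => hb (rot_injective h)
    · simp [PState.rot, hball]
    · simp [PState.rot, hchaps, Finset.image_insert]
  · exact ⟨by simp [PState.rot, ht], .inr hj.rot⟩

theorem winner_rot (s : PState) : winner 12 s.rot = (winner 12 s).map (!·) := by
  have h₁ : 12 ≤ s.rot.ball.2 ↔ s.ball.2 ≤ 1 := by
    simp only [PState.rot, _root_.rot]
    omega
  have h₂ : s.rot.ball.2 ≤ 1 ↔ 12 ≤ s.ball.2 := by
    simp only [PState.rot, _root_.rot]
    omega
  simp only [winner, h₁, h₂]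
  split_ifs <;> first | rfl | (exfalso; omega)

/-- Alfred draws from a position if the half turn of this position lies in an invariant set
that makes Betty draw. -/
theorem drawsFrom_true_of_rot_invariant {s₀ : PState} (I : PState → Prop)
    (start : I s₀.rot) (not_lost : ∀ s, I s → winner 12 s ≠ some true)
    (own : ∀ s, I s → s.turn = false → winner 12 s = none → ∃ t, MoveRel 12 10 s t ∧ I t)
    (opp : ∀ s t, I s → s.turn = true → winner 12 s = none → MoveRel 12 10 s t → I t) :
    DrawsFrom 12 10 true s₀ := by
  refine drawsFrom_of_invariant (fun s => I s.rot) start (fun s hs hw => ?_)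
    (fun s hs ht hw => ?_) (fun s t hs ht hw hm => ?_)
  · exact not_lost _ hs (by simp [winner_rot, hw])
  · obtain ⟨t, hm, hI⟩ := own s.rot hs (by simp [PState.rot, ht]) (by simp [winner_rot, hw])
    exact ⟨t.rot, by simpa using hm.rot, by simpa using hI⟩
  · exact opp _ _ hs (by simp [PState.rot, ht]) (by simp [winner_rot, hw]) hm.rot

/-! ### Partially known boards

A set of points of the board is encoded by a natural number, the point `(x, y)` being bit
`x + 12 * y`. -/

/-- Boolean version of `OnBoard 12 10`. -/
def onBoard (p : ℤ × ℤ) : Bool := decide (1 ≤ p.1 ∧ p.1 ≤ 10 ∧ 1 ≤ p.2 ∧ p.2 ≤ 12)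

/-- The index of the bit that encodes a point. -/
def cell (p : ℤ × ℤ) : ℕ := (p.1 + 12 * p.2).toNat

/-- The point `p` is on the board and belongs to the set encoded by `B`. -/
def has (B : ℕ) (p : ℤ × ℤ) : Bool := onBoard p && B.testBit (cell p)

/-- The point `p` is outside of the board or belongs to the set encoded by `T`. -/
def known (T : ℕ) (p : ℤ × ℤ) : Bool := !onBoard p || T.testBit (cell p)

/-- Adjoin a point to the set encoded by `B`. -/
def addPt (B : ℕ) (p : ℤ × ℤ) : ℕ := B ||| 2 ^ cell p

/-- Remove a point from the set encoded by `B`, to which it belongs. -/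
def delPt (B : ℕ) (p : ℤ × ℤ) : ℕ := B ^^^ 2 ^ cell p

/-- The set of chaps `c` is encoded by `K` as far as the points encoded by `T` are concerned. -/
def Encodes (K T : ℕ) (c : Finset (ℤ × ℤ)) : Prop :=
  ∀ p, known T p = true → (p ∈ c ↔ has K p = true)

theorem onBoard_iff {p : ℤ × ℤ} : onBoard p = true ↔ OnBoard 12 10 p := by
  simp [onBoard, OnBoard]

theorem cell_inj {p q : ℤ × ℤ} (hp : onBoard p = true) (hq : onBoard q = true) :
    cell p = cell q ↔ p = q := by
  rw [onBoard_iff] at hp hq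
  simp only [OnBoard] at hp hq
  simp only [cell, Prod.ext_iff]
  omega

theorem has_addPt {B : ℕ} {p q : ℤ × ℤ} (hp : onBoard p = true) :
    has (addPt B p) q = (has B q || decide (q = p)) := by
  by_cases hq : onBoard q = true
  · simp [has, addPt, hq, Nat.testBit_or, Nat.testBit_two_pow, cell_inj hp hq, eq_comm]
  · have : q ≠ p := fun h => hq (h ▸ hp)
    simp [has, hq, this]

theorem known_addPt {T : ℕ} {p q : ℤ × ℤ} (hp : onBoard p = true) :
    known (addPt T p) q = (known T q || decide (q = p)) := by
  by_cases hq : onBoard q = true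
  · simp [known, addPt, hq, Nat.testBit_or, Nat.testBit_two_pow, cell_inj hp hq, eq_comm]
  · simp [known, hq]

theorem has_delPt {B : ℕ} {p q : ℤ × ℤ} (hp : has B p = true) :
    has (delPt B p) q = (has B q && !decide (q = p)) := by
  simp only [has, Bool.and_eq_true] at hp
  by_cases hq : onBoard q = true
  · by_cases h : q = p
    · subst h
      simp [has, delPt, hp.2, Nat.testBit_xor]
    · have h' : cell p ≠ cell q := fun e => h ((cell_inj hp.1 hq).1 e).symm
      simp [has, delPt, hq, Nat.testBit_xor, h, h']
  · simp [has, hq]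

theorem Encodes.insert {K T : ℕ} {c : Finset (ℤ × ℤ)} {p : ℤ × ℤ} (h : Encodes K T c)
    (hp : onBoard p = true) : Encodes (addPt K p) (addPt T p) (insert p c) := by
  intro q hq
  rw [known_addPt hp] at hq
  rw [has_addPt hp]
  by_cases hqp : q = p
  · simp [hqp]
  · simp only [hqp, decide_false, Bool.or_false, Finset.mem_insert, false_or] at hq ⊢
    exact h q hq

theorem Encodes.insert_known {K T : ℕ} {c : Finset (ℤ × ℤ)} {p : ℤ × ℤ} (h : Encodes K T c)
    (hp : onBoard p = true) : Encodes (addPt K p) T (Insert.insert p c) := fun q hq =>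
  h.insert hp q (by simp [known_addPt hp, hq])

theorem Encodes.insert_unknown {K T : ℕ} {c : Finset (ℤ × ℤ)} {p : ℤ × ℤ} (h : Encodes K T c)
    (hp : known T p = false) : Encodes K T (Insert.insert p c) := by
  intro q hq
  have : q ≠ p := by
    rintro rfl
    simp [hp] at hq
  simpa [this] using h q hq

theorem Encodes.erase {K T : ℕ} {c c' : Finset (ℤ × ℤ)} {p : ℤ × ℤ} (h : Encodes K T c)
    (hp : has K p = true) (hc : ∀ q, q ∈ c' ↔ q ∈ c ∧ q ≠ p) : Encodes (delPt K p) T c' := by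
  intro q hq
  rw [has_delPt hp, hc, h q hq]
  simp

/-! ### Hops and jumps on partially known boards -/

/-- One step from `p` in direction `d`. -/
def step (p d : ℤ × ℤ) : ℤ × ℤ := (p.1 + d.1, p.2 + d.2)

/-- Walk from `p` in direction `d` over chaps, removing them, up to the first vacant point. The
result is `none` if an unknown point is met. -/
def scan (T : ℕ) (d : ℤ × ℤ) : ℕ → ℤ × ℤ → ℕ → Option ((ℤ × ℤ) × ℕ)
  | 0, _, _ => none
  | n + 1, p, K =>
    if known T p then
      if has K p then scan T d n (step p d) (delPt K p) else some (p, K)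
    else none

theorem ray_one (b d : ℤ × ℤ) : ray b d 1 = step b d := by simp [ray, step]

theorem step_ray (b d : ℤ × ℤ) (i : ℤ) : step (ray b d i) d = ray b d (i + 1) := by
  ext <;> simp [ray, step] <;> ring

theorem ray_injective {b d : ℤ × ℤ} (hd : d ∈ dirs) {i j : ℤ} (h : ray b d i = ray b d j) :
    i = j := by
  simp only [dirs, Finset.mem_insert, Finset.mem_singleton] at hd
  rcases hd with rfl | rfl | rfl | rfl | rfl | rfl | rfl | rfl <;>
    simp [ray] at h <;> omega

/-- The first `k` points on a ray. -/
def run (b d : ℤ × ℤ) (k : ℕ) : Finset (ℤ × ℤ) :=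
  Finset.image (fun i : ℕ => ray b d i) (Finset.Icc 1 k)

theorem mem_run {b d p : ℤ × ℤ} {k : ℕ} :
    p ∈ run b d k ↔ ∃ i : ℕ, (1 ≤ i ∧ i ≤ k) ∧ ray b d i = p := by
  simp [run]

theorem scan_spec_aux {T : ℕ} {b d : ℤ × ℤ} {c : Finset (ℤ × ℤ)} (hd : d ∈ dirs) (n j K : ℕ)
    {q : ℤ × ℤ} {K' : ℕ} (h : scan T d n (ray b d (j + 1)) K = some (q, K'))
    (hrep : Encodes K T (c \ run b d j)) (hin : ∀ i : ℕ, 1 ≤ i → i ≤ j → ray b d i ∈ c) :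
    ∃ k : ℕ, (∀ i : ℕ, 1 ≤ i → i ≤ k → ray b d i ∈ c) ∧ ray b d (k + 1) ∉ c ∧
      q = ray b d (k + 1) ∧ Encodes K' T (c \ run b d k) := by
  induction n generalizing j K with
  | zero => simp [scan] at h
  | succ n ih =>
    have hnot : ray b d (j + 1) ∉ run b d j := by
      rw [mem_run]
      rintro ⟨i, hi, e⟩
      have := ray_injective hd e
      omega
    rw [scan] at h
    split_ifs at h with hk hh
    · have hmem : ray b d (j + 1) ∈ c := (Finset.mem_sdiff.1 ((hrep _ hk).2 hh)).1
      refine ih (j + 1) (delPt K (ray b d (j + 1))) ?_ (hrep.erase hh fun q => ?_) ?_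
      · rw [step_ray] at h
        exact_mod_cast h
      · have : q ∈ run b d (j + 1) ↔ q ∈ run b d j ∨ q = ray b d (j + 1) := by
          simp only [mem_run]
          constructor
          · rintro ⟨i, hi, rfl⟩
            by_cases hij : i ≤ j
            · exact .inl ⟨i, ⟨hi.1, hij⟩, rfl⟩
            · obtain rfl : i = j + 1 := by omega
              exact .inr (by push_cast; rfl)
          · rintro (⟨i, hi, rfl⟩ | rfl)
            · exact ⟨i, ⟨hi.1, by omega⟩, rfl⟩
            · exact ⟨j + 1, by omega, by push_cast; rfl⟩
        simp only [Finset.mem_sdiff, this]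
        tauto
      · intro i hi hij
        by_cases h' : i ≤ j
        · exact hin i hi h'
        · obtain rfl : i = j + 1 := by omega
          exact_mod_cast hmem
    · obtain ⟨rfl, rfl⟩ : ray b d (j + 1) = q ∧ K = K' := by simpa using h
      refine ⟨j, hin, fun hc => hh ((hrep _ hk).1 (Finset.mem_sdiff.2 ⟨hc, hnot⟩)), rfl, hrep⟩

theorem scan_spec {T n K K' : ℕ} {b d q : ℤ × ℤ} {c : Finset (ℤ × ℤ)} (hd : d ∈ dirs)
    (h : scan T d n (step b d) K = some (q, K')) (hrep : Encodes K T c) :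
    ∃ k : ℕ, (∀ i : ℕ, 1 ≤ i → i ≤ k → ray b d i ∈ c) ∧ ray b d (k + 1) ∉ c ∧
      q = ray b d (k + 1) ∧ Encodes K' T (c \ run b d k) := by
  refine scan_spec_aux hd n 0 K (by simpa [ray_one] using h) (by simpa [run] using hrep) ?_
  intro i hi hi'
  omega

/-- Every hop in direction `d` is the one found by `scan`. -/
theorem Hop.of_scan {T n K K' : ℕ} {b d q b' : ℤ × ℤ} {c c' : Finset (ℤ × ℤ)} {k : ℕ}
    (hd : d ∈ dirs) (h : scan T d n (step b d) K = some (q, K')) (hrep : Encodes K T c) (hk : 1 ≤ k)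
    (hin : ∀ i : ℕ, 1 ≤ i → i ≤ k → ray b d i ∈ c) (hout : ray b d (k + 1) ∉ c)
    (hb : b' = ray b d (k + 1)) (hc : c' = c \ run b d k) :
    q = b' ∧ q ≠ step b d ∧ Encodes K' T c' := by
  obtain ⟨l, hin', hout', rfl, hrep'⟩ := scan_spec hd h hrep
  have hkl : k = l := by
    by_contra hne
    rcases Nat.lt_or_gt_of_ne hne with hlt | hlt
    · exact hout (by exact_mod_cast hin' (k + 1) (by omega) hlt)
    · exact hout' (by exact_mod_cast hin (l + 1) (by omega) hlt)
  subst hkl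
  refine ⟨hb.symm, fun e => ?_, hc ▸ hrep'⟩
  rw [← ray_one] at e
  have := ray_injective hd e
  omega

/-- The eight directions as a list. -/
def dirList : List (ℤ × ℤ) :=
  [(1, 0), (1, 1), (0, 1), (-1, 1), (-1, 0), (-1, -1), (0, -1), (1, -1)]

theorem mem_dirList {d : ℤ × ℤ} : d ∈ dirList ↔ d ∈ dirs := by
  simp [dirList, dirs]

/-- The landing point and the remaining chaps of a hop. -/
def hop? (T : ℕ) (b : ℤ × ℤ) (K : ℕ) (d : ℤ × ℤ) : Option ((ℤ × ℤ) × ℕ) :=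
  match scan T d 13 (step b d) K with
  | none => none
  | some (q, K') =>
    if dirList.contains d && q != step b d && decide (1 ≤ q.1 ∧ q.1 ≤ 10) then some (q, K')
    else none

theorem hop_of_hop? {T K K' : ℕ} {b d q : ℤ × ℤ} {c : Finset (ℤ × ℤ)}
    (h : hop? T b K d = some (q, K')) (hrep : Encodes K T c) :
    ∃ c', Hop 10 b c q c' ∧ Encodes K' T c' := by
  unfold hop? at h
  split at h
  · simp at h
  · rename_i q₁ K₁ hs
    split_ifs at h with hc
    obtain ⟨rfl, rfl⟩ : q₁ = q ∧ K₁ = K' := by simpa using h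
    simp only [Bool.and_eq_true, List.contains_iff_mem, mem_dirList, bne_iff_ne,
      decide_eq_true_eq] at hc
    obtain ⟨⟨hd, hne⟩, h1, h2⟩ := hc
    obtain ⟨k, hin, hout, rfl, hrep'⟩ := scan_spec hd hs hrep
    have hk : 1 ≤ k := by
      by_contra hk
      obtain rfl : k = 0 := by omega
      exact hne (by simp [ray_one])
    exact ⟨_, ⟨d, hd, k, hk, hin, hout, h1, h2, rfl, rfl⟩, hrep'⟩

/-- The ball and the remaining chaps after hops in the given directions. -/
def jump? (T : ℕ) : List (ℤ × ℤ) → ℤ × ℤ → ℕ → Option ((ℤ × ℤ) × ℕ)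
  | [], _, _ => none
  | d :: ds, b, K =>
    match hop? T b K d with
    | none => none
    | some (q, K') =>
      if ds.isEmpty then some (q, K')
      else if decide (1 ≤ q.2 ∧ q.2 ≤ 12) then jump? T ds q K' else none

theorem jump_of_jump? {T : ℕ} {ds : List (ℤ × ℤ)} {b q : ℤ × ℤ} {K K' : ℕ}
    {c : Finset (ℤ × ℤ)} (h : jump? T ds b K = some (q, K')) (hrep : Encodes K T c) :
    ∃ c', Jump 12 10 b c q c' ∧ Encodes K' T c' := by
  induction ds generalizing b K c with
  | nil => simp [jump?] at h
  | cons d ds ih =>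
    unfold jump? at h
    split at h
    · simp at h
    · rename_i q₁ K₁ hs
      obtain ⟨c₁, hhop, hrep₁⟩ := hop_of_hop? hs hrep
      split_ifs at h with h1 h2
      · obtain ⟨rfl, rfl⟩ : q₁ = q ∧ K₁ = K' := by simpa using h
        exact ⟨c₁, .single hhop, hrep₁⟩
      · simp only [decide_eq_true_eq] at h2
        obtain ⟨c', hj, hrep'⟩ := ih h hrep₁
        exact ⟨c', .cons hhop h2.1 h2.2 hj, hrep'⟩

/-- All jumps from `b` are determined by the known points, none of them reaches the top row, and
those that do not reach the bottom row lead to a ball and chaps satisfying `P`. -/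
def jumpsOk (T : ℕ) (P : ℤ × ℤ → ℕ → Bool) : ℕ → ℤ × ℤ → ℕ → Bool
  | 0, _, _ => false
  | n + 1, b, K =>
    dirList.all fun d =>
      match scan T d 13 (step b d) K with
      | none => false
      | some (q, K') =>
        q == step b d || !decide (1 ≤ q.1 ∧ q.1 ≤ 10) || decide (q.2 ≤ 0) ||
          ((decide (q.2 ≤ 1) || (decide (q.2 ≤ 11) && P q K')) && jumpsOk T P n q K')

theorem jumpsOk_spec {T : ℕ} {P : ℤ × ℤ → ℕ → Bool} {b b' : ℤ × ℤ} {c c' : Finset (ℤ × ℤ)}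
    (hj : Jump 12 10 b c b' c') {n K : ℕ} (h : jumpsOk T P n b K = true) (hrep : Encodes K T c) :
    b'.2 ≤ 1 ∨ ∃ K', Encodes K' T c' ∧ P b' K' = true := by
  have hop : ∀ {b b₁ : ℤ × ℤ} {c c₁ : Finset (ℤ × ℤ)} {n K : ℕ}, Hop 10 b c b₁ c₁ →
      jumpsOk T P n b K = true → Encodes K T c → b₁.2 ≤ 0 ∨ ∃ n' K', Encodes K' T c₁ ∧
        (b₁.2 ≤ 1 ∨ P b₁ K' = true) ∧ jumpsOk T P n' b₁ K' = true := by
    rintro b b₁ c c₁ n K ⟨d, hd, k, hk, hin, hout, h1, h2, hb, hc⟩ h hrep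
    cases n with
    | zero => simp [jumpsOk] at h
    | succ n =>
      rw [jumpsOk, List.all_eq_true] at h
      have h' := h d (mem_dirList.2 hd)
      split at h'
      · simp at h'
      · rename_i q K' hs
        obtain ⟨rfl, hne, hrep'⟩ := Hop.of_scan hd hs hrep hk hin hout hb hc
        rw [← hb] at h1 h2
        simp only [Bool.or_eq_true, Bool.and_eq_true, beq_iff_eq, hne, h1, h2, and_self,
          decide_true, Bool.not_true, Bool.false_eq_true, false_or, decide_eq_true_eq] at h'
        rcases h' with h' | ⟨h', h''⟩
        · exact .inl h'
        · exact .inr ⟨n, K', hrep', h'.imp id And.right, h''⟩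
  induction hj generalizing n K with
  | single hh =>
    rcases hop hh h hrep with h' | ⟨_, K', hrep', h', _⟩
    · exact .inl (by omega)
    · exact h'.imp id fun hP => ⟨K', hrep', hP⟩
  | cons hh h1 _ _ ih =>
    rcases hop hh h hrep with h' | ⟨n', K', hrep', _, h''⟩
    · omega
    · exact ih h'' hrep'

/-! ### Tables of moves for Betty -/

/-- A move in a table. -/
inductive TableMove
  | place (p : ℤ × ℤ)
  | jump (ds : List (ℤ × ℤ))

/-- A move for Betty in all positions with a given ball whose chaps among the points encoded by
`mask` are those encoded by `chaps`. -/
structure Entry where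
  ball : ℤ × ℤ
  chaps : ℕ
  mask : ℕ
  move : TableMove

/-- The entry applies to all positions with ball `b` and chaps represented by `K` and `T`. -/
def Entry.applies (e : Entry) (b : ℤ × ℤ) (K T : ℕ) : Bool :=
  e.ball == b && T &&& e.mask == e.mask && K &&& e.mask == e.chaps

theorem Entry.rep_of_applies {e : Entry} {b : ℤ × ℤ} {K T : ℕ} {c : Finset (ℤ × ℤ)}
    (h : e.applies b K T = true) (hrep : Encodes K T c) :
    e.ball = b ∧ Encodes e.chaps e.mask c := by
  simp only [Entry.applies, Bool.and_eq_true, beq_iff_eq] at h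
  obtain ⟨⟨hb, hT⟩, hK⟩ := h
  refine ⟨hb, fun p hp => ?_⟩
  have hpT : known T p = true := by
    rw [← hT] at hp
    simp only [known, Nat.testBit_and, Bool.or_eq_true, Bool.and_eq_true] at hp ⊢
    tauto
  rw [hrep p hpT, ← hK]
  simp only [known, Bool.or_eq_true, Bool.not_eq_true'] at hp
  simp only [has, Nat.testBit_and, Bool.and_eq_true]
  constructor
  · rintro ⟨h1, h2⟩
    exact ⟨h1, h2, hp.resolve_left (by simp [h1])⟩
  · tauto

/-- The points of the board. -/
def points : List (ℤ × ℤ) :=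
  (List.range 120).map fun i => (((i % 10 + 1 : ℕ) : ℤ), ((i / 10 + 1 : ℕ) : ℤ))

theorem mem_points {p : ℤ × ℤ} (hp : onBoard p = true) : p ∈ points := by
  rw [onBoard_iff] at hp
  obtain ⟨h1, h2, h3, h4⟩ := hp
  simp only [points, List.mem_map, List.mem_range, Prod.ext_iff]
  exact ⟨((p.2 - 1) * 10 + (p.1 - 1)).toNat, by omega, by omega, by omega⟩

/-- All moves of Alfred lead to a win for Betty or to a position in the table. -/
def replied (tbl : List Entry) (b : ℤ × ℤ) (K T : ℕ) : Bool :=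
  decide (b.2 ≤ 11) &&
  jumpsOk T (fun q K' => tbl.any fun e => e.applies q K' T) 20 b K &&
  points.all fun p => p == b || (known T p && has K p) ||
    (tbl.any fun e => !known e.mask p && e.applies b K T) ||
    (tbl.any fun e => e.applies b (addPt K p) (addPt T p))

/-- The move of the entry is legal, and it wins or leaves Alfred in a position where all of his
moves are answered by the table. -/
def Entry.ok (tbl : List Entry) (e : Entry) : Bool :=
  decide (e.ball.2 ≤ 11) &&
  match e.move with
  | .place p => onBoard p && known e.mask p && !has e.chaps p && p != e.ball &&
      replied tbl e.ball (addPt e.chaps p) e.mask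
  | .jump ds =>
    match jump? e.mask ds e.ball e.chaps with
    | none => false
    | some (q, K') => decide (q.2 ≤ 1) || replied tbl q K' e.mask

/-- The position is won for Betty, or Betty is to move and it is in the table, or Alfred is to
move and all of his moves are answered by the table. -/
def Held (tbl : List Entry) (s : PState) : Prop :=
  s.ball.2 ≤ 1 ∨
  (s.turn = false ∧ ∃ e ∈ tbl, e.ball = s.ball ∧ Encodes e.chaps e.mask s.chaps) ∨
  (s.turn = true ∧ ∃ K T, Encodes K T s.chaps ∧ replied tbl s.ball K T = true)

theorem Held.winner_ne {tbl : List Entry} (htbl : ∀ e ∈ tbl, e.ok tbl = true) {s : PState}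
    (h : Held tbl s) : winner 12 s ≠ some true := by
  have : s.ball.2 ≤ 11 := by
    rcases h with h | ⟨_, e, he, hb, _⟩ | ⟨_, K, T, _, h⟩
    · omega
    · have := htbl e he
      simp only [Entry.ok, Bool.and_eq_true, decide_eq_true_eq] at this
      exact hb ▸ this.1
    · simp only [replied, Bool.and_eq_true, decide_eq_true_eq] at h
      exact h.1.1
  simp only [winner]
  split_ifs
  · omega
  · simp
  · simp

theorem Held.exists_move {tbl : List Entry} (htbl : ∀ e ∈ tbl, e.ok tbl = true) {s : PState}
    (h : Held tbl s) (ht : s.turn = false) (hw : winner 12 s = none) :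
    ∃ t, MoveRel 12 10 s t ∧ Held tbl t := by
  rcases h with h | ⟨_, e, he, hb, hrep⟩ | ⟨h, _⟩
  · simp only [winner, h, if_true] at hw
    split at hw <;> simp at hw
  · have hok := htbl e he
    simp only [Entry.ok, Bool.and_eq_true] at hok
    replace hok := hok.2
    split at hok
    · rename_i p _
      simp only [Bool.and_eq_true, Bool.not_eq_true', bne_iff_ne] at hok
      obtain ⟨⟨⟨⟨hp, hk⟩, hh⟩, hne⟩, hr⟩ := hok
      refine ⟨⟨s.ball, insert p s.chaps, true⟩, ⟨by simp [ht], .inl ⟨p, onBoard_iff.1 hp, ?_,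
        hb ▸ hne, rfl, rfl⟩⟩, .inr (.inr ⟨rfl, _, _, hrep.insert_known hp, hb ▸ hr⟩)⟩
      rw [hrep p hk, hh]
      simp
    · split at hok
      · simp at hok
      · rename_i q K' hj
        obtain ⟨c', hjump, hrep'⟩ := jump_of_jump? hj hrep
        refine ⟨⟨q, c', true⟩, ⟨by simp [ht], .inr (hb ▸ hjump)⟩, ?_⟩
        simp only [Bool.or_eq_true, decide_eq_true_eq] at hok
        exact hok.imp id fun hr => .inr ⟨rfl, _, _, hrep', hr⟩
  · simp [ht] at h

theorem Held.of_move {tbl : List Entry} {s t : PState} (h : Held tbl s) (ht : s.turn = true)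
    (hw : winner 12 s = none) (hm : MoveRel 12 10 s t) : Held tbl t := by
  obtain ⟨htt, hm⟩ := hm
  have htt' : t.turn = false := by simp [htt, ht]
  rcases h with h | ⟨h, _⟩ | ⟨_, K, T, hrep, hr⟩
  · simp only [winner, h, if_true] at hw
    split at hw <;> simp at hw
  · simp [ht] at h
  · have applied : ∀ {e : Entry} {K T : ℕ}, e ∈ tbl → e.applies t.ball K T = true →
        Encodes K T t.chaps → Held tbl t := fun he ha hrep =>
      .inr (.inl ⟨htt', _, he, Entry.rep_of_applies ha hrep⟩)
    simp only [replied, Bool.and_eq_true, List.all_eq_true] at hr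
    obtain ⟨⟨_, hjumps⟩, hplace⟩ := hr
    rcases hm with ⟨p, hp, hpc, hpb, hball, hchaps⟩ | hj
    · rw [← onBoard_iff] at hp
      have := hplace p (mem_points hp)
      simp only [Bool.or_eq_true, Bool.and_eq_true, beq_iff_eq, List.any_eq_true,
        Bool.not_eq_true'] at this
      rw [← hball] at this
      rcases this with ((h | ⟨hk, hh⟩) | ⟨e, he, hk, ha⟩) | ⟨e, he, ha⟩
      · exact absurd (h.trans hball) hpb
      · exact absurd ((hrep p hk).2 hh) hpc
      · obtain ⟨hb, hrep'⟩ := Entry.rep_of_applies ha hrep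
        exact .inr (.inl ⟨htt', e, he, hb, hchaps ▸ hrep'.insert_unknown hk⟩)
      · exact applied he ha (hchaps ▸ hrep.insert hp)
    · rcases jumpsOk_spec hj hjumps hrep with h | ⟨K', hrep', h⟩
      · exact .inl h
      · obtain ⟨e, he, ha⟩ := List.any_eq_true.1 h
        exact applied he ha hrep'

/-! ### The table for `P0` -/

/-- All points of the board. -/
def fullMask : ℕ := 45638466880021785266250597798191621767644045312

/-- The chaps of `P0`. -/
def P0mask : ℕ := 6602632166712011601641779586543207578491715584

/-- Betty's moves. The entries with `fullMask` make up the cycle of forced moves in which the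
ball travels between a2 and j11; the other ones punish Alfred for leaving this cycle. -/
def table : List Entry :=
  [⟨(1, 2), 6602632166795098493821229827896735745331986432, fullMask, .place (9, 10)⟩,
   ⟨(1, 2), 6602632166712011602879870760005035830438821888, fullMask, .place (7, 8)⟩,
   ⟨(1, 2), 6602632166712011601641779604992203726892859392, fullMask, .place (5, 6)⟩,
   ⟨(1, 2), 6602632166712011601641779586543207853369622528, fullMask, .place (3, 4)⟩,
   ⟨(10, 11), 6602632847359832335698156754645950608868409344, fullMask, .jump [(-1, -1)]⟩,
   ⟨(10, 11), 6602632847359832335698156754643698534176817152, fullMask, .place (3, 4)⟩,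
   ⟨(10, 11), 6602632847359832335698005620469502631820427264, fullMask, .place (5, 6)⟩,
   ⟨(10, 11), 6602632847359822193255263755348910383295660032, fullMask, .place (7, 8)⟩,
   ⟨(10, 11), P0mask, fullMask, .place (9, 10)⟩,
   ⟨(1, 2), 8192, 8192, .jump [(0, -1)]⟩,
   ⟨(1, 2), 0, 412383993856, .place (1, 1)⟩,
   ⟨(1, 2), 16384, 16384, .jump [(1, -1)]⟩,
   ⟨(1, 2), 201359360, 469794816, .jump [(1, 0), (-1, -1)]⟩,
   ⟨(1, 2), 137573203968, 6919218290858647552, .place (1, 1)⟩,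
   ⟨(1, 2), 11259275020337152, 18458007746776399872, .jump [(1, 1), (1, -1), (0, -1)]⟩,
   ⟨(1, 2), 11263671993106432, 18458007747850141696, .jump [(1, 1), (1, -1), (-1, -1)]⟩,
   ⟨(1, 2), 2477240138638898346540924928, 8666940630213704900389371904,
      .jump [(1, 1), (1, 0), (0, -1), (0, -1)]⟩,
   ⟨(1, 2), 2477240433786803525893750784, 8666940630213704900389371904,
      .jump [(1, 1), (1, 0), (0, -1)]⟩,
   ⟨(1, 2), 30424853705576859153992518729728, 83107179542023271205068212735574016,
      .jump [(1, 1), (0, -1), (0, -1), (0, -1)]⟩,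
   ⟨(1, 2), 30424853705872007059171871555584, 83107179542023271205068212735574016,
      .jump [(1, 1), (0, -1), (0, -1)]⟩,
   ⟨(1, 2), 30429805465734000675092115226624, 83107179542023271205068212735574016,
      .jump [(1, 1), (0, -1), (0, -1)]⟩,
   ⟨(1, 2), 5575866947453389841761097670905120753188864,
      5575866947453389841761097670905258259275776,
      .place (1, 1)⟩,
   ⟨(1, 2), 412451078144, 563362404564992, .jump [(0, 1), (1, -1)]⟩,
   ⟨(1, 2), 680647820734056377168102743030510944256, 5575866947453389841761097671468208615448576,
      .place (10, 11)⟩,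
   ⟨(1, 2), 201392128, 469827584, .jump [(1, 0), (0, -1)]⟩,
   ⟨(1, 2), 412451143680, 563362404564992, .jump [(0, 1), (1, -1)]⟩,
   ⟨(1, 2), 680647820734056377168102743030510977024, 5575866947453389841761097671468208615415808,
      .place (10, 11)⟩,
   ⟨(1, 2), 470024192, 1006895104, .jump [(1, 0), (1, -1)]⟩,
   ⟨(1, 2), 680647820734056377168102743030779609088, 5575866947453389841761097671468209152548864,
      .place (10, 11)⟩,
   ⟨(1, 2), 680647841019097887896242957983077924864,
      34262309956801087651148637501257834968419131392,
      .place (2, 1)⟩,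
   ⟨(1, 2), 7429000295780401853950328832, 18570460796922812102091472896,
      .jump [(1, 1), (1, 0), (-1, -1), (1, -1), (-1, -1)]⟩,
   ⟨(2, 3), 134217728, 134283264, .jump [(1, -1)]⟩,
   ⟨(4, 3), 134234112, 134234112, .jump [(-1, -1)]⟩,
   ⟨(6, 3), 1074003968, 1074003968, .jump [(0, -1)]⟩,
   ⟨(1, 4), 275012124672, 275012190208, .jump [(1, -1)]⟩,
   ⟨(1, 4), 275012190208, 275012190208, .jump [(1, -1)]⟩,
   ⟨(1, 4), 134258688, 6918655340905226240, .place (2, 3)⟩,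
   ⟨(2, 5), 1125900041060352, 1126174919032832, .jump [(0, -1), (1, -1)]⟩,
   ⟨(2, 5), 1125900041125888, 1126174919032832, .jump [(0, -1), (1, -1)]⟩,
   ⟨(2, 5), 1126174784782336, 1126174851891200, .jump [(0, -1), (1, -1)]⟩,
   ⟨(2, 5), 134250496, 66124663916833888526336, .place (2, 4)⟩,
   ⟨(2, 5), 9232379237183520768, 27679127708939583488, .jump [(1, 0), (1, -1), (0, -1)]⟩,
   ⟨(2, 5), 1126174784765952, 1126174851874816, .jump [(0, -1), (0, -1)]⟩,
   ⟨(2, 5), 562950087688192, 66124663916833888526336, .place (2, 4)⟩,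
   ⟨(4, 5), 9007200328744960, 9011598375256064, .jump [(1, -1), (0, -1)]⟩,
   ⟨(6, 5), 9007199388975104, 9008298900602880, .jump [(-1, -1), (-1, -1)]⟩,
   ⟨(8, 5), 72075190519988224, 72075190519988224, .jump [(0, -1)]⟩,
   ⟨(2, 7), 37778940870157490454528, 37797387618629246517248, .jump [(1, -1), (1, -1), (0, -1)]⟩,
   ⟨(2, 7), 37778940874554463223808, 37797387618630320259072, .jump [(1, -1), (1, -1), (-1, -1)]⟩,
   ⟨(2, 7), 37797387614231200006144, 37797387618629246517248, .jump [(1, -1), (0, -1)]⟩,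
   ⟨(2, 7), 9232379237317771264, 1109387996189113649184777953280, .place (3, 6)⟩,
   ⟨(2, 7), 154893620647131562398203904, 464378704255454025472819200,
      .jump [(1, 0), (1, -1), (-1, -1), (-1, -1)]⟩,
   ⟨(2, 7), 154893620647132661909831680, 464378704255454025472819200,
      .jump [(1, 0), (1, -1), (-1, -1)]⟩,
   ⟨(2, 7), 154893694425118250034528256, 464378704282492124368207872,
      .jump [(1, 0), (1, -1), (1, -1), (-1, -1)]⟩,
   ⟨(2, 7), 464378630468476632062492672, 1083348687004657115954937856,
      .jump [(1, 0), (0, -1), (0, -1), (1, -1)]⟩,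
   ⟨(2, 7), 151115736476621296648192, 4913269158784402199840976027648, .place (3, 7)⟩,
   ⟨(2, 7), 9232942187271208960, 1109387996189113649184777953280, .place (3, 6)⟩,
   ⟨(4, 7), 37788164242194345230336, 37811222676684528680960,
      .jump [(-1, -1), (1, 0), (1, -1), (0, -1)]⟩,
   ⟨(4, 7), 37788164246591317999616, 37811222676685602422784,
      .jump [(-1, -1), (1, 0), (1, -1), (-1, -1)]⟩,
   ⟨(4, 7), 154780283851542691852845056, 232151554753627430790103040,
      .jump [(-1, 0), (1, -1), (1, -1), (0, -1)]⟩,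
   ⟨(4, 7), 37806610986268054519808, 37848116162632924790784,
      .jump [(-1, -1), (1, 0), (0, -1), (1, -1)]⟩,
   ⟨(4, 7), 154742514143051771680161792, 4913036138145899880079518851072, .place (3, 6)⟩,
   ⟨(4, 7), 151115736459028035813376, 151189523436422385647616,
      .jump [(1, -1), (-1, -1), (-1, -1)]⟩,
   ⟨(4, 7), 151115736460127547441152, 151189523436422385647616, .jump [(1, -1), (-1, -1)]⟩,
   ⟨(4, 7), 151189514445715672137728, 151189550474521281036288, .jump [(1, -1), (1, -1), (-1, -1)]⟩,
   ⟨(4, 7), 154742504919697327012200448, 4913346530036857536108157222912, .place (5, 6)⟩,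
   ⟨(6, 7), 2477089004462450369492942848, 7428849456751876648442265600,
      .jump [(1, 0), (0, -1), (0, -1)]⟩,
   ⟨(6, 7), 2477089299610355548845768704, 7428849456751876648442265600, .jump [(1, 0), (0, -1)]⟩,
   ⟨(6, 7), 7428849161603953876902346752, 17332369623460983850144366592,
      .jump [(1, 0), (-1, -1), (1, -1), (-1, -1)]⟩,
   ⟨(6, 7), 1208925891689819694694400, 78612292030340681835957410332672, .place (7, 7)⟩,
   ⟨(8, 7), 1208925891689819694694400, 1209221039594999047520256, .jump [(0, -1), (0, -1)]⟩,
   ⟨(8, 9), 20282410812577562113766945980416, 20287362573029851540045895303168,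
      .jump [(0, -1), (0, -1), (0, -1)]⟩,
   ⟨(8, 9), 20282410812872710018946298806272, 20287362573029851540045895303168,
      .jump [(0, -1), (0, -1)]⟩,
   ⟨(8, 9), 20287362572734703634866542477312, 20287362573029851540045895303168,
      .jump [(0, -1), (0, -1)]⟩,
   ⟨(8, 9), 1208925891689819694694400, 1191196047103395020831432692033785954304, .place (8, 8)⟩,
   ⟨(10, 11), 680564754124287739504311328630482403328, 680647830878976057198657242850699247616,
      .jump [(-1, -1), (0, -1), (0, -1), (0, -1)]⟩,
   ⟨(10, 11), 680564754124287739799459233809835229184, 680647830878976057198657242850699247616,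
      .jump [(-1, -1), (0, -1), (0, -1)]⟩,
   ⟨(10, 11), 680564754129239499661452849730078900224, 680647830878976057198657242850699247616,
      .jump [(-1, -1), (0, -1), (0, -1)]⟩,
   ⟨(10, 11), 680647820735295374999103365147922530304, 680647820741485075490678171701770977280,
      .jump [(-1, -1), (1, 0), (0, -1), (0, -1)]⟩,
   ⟨(10, 11), 680647820735295375294251270327275356160, 680647820741485075490678171701770977280,
      .jump [(-1, -1), (1, 0), (0, -1)]⟩,
   ⟨(10, 11), 680647820734056377149662754082304294912, 680647820734056377168109502554060357632,
      .jump [(-1, -1), (1, -1), (0, -1)]⟩,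
   ⟨(10, 11), 680647820734056377149662758479277064192, 680647820734056377168109502555134099456,
      .jump [(-1, -1), (1, -1), (-1, -1)]⟩,
   ⟨(10, 11), 680647820734056377168102742755633004544, 680647820734056377168102743030510977024,
      .jump [(-1, -1), (1, -1)]⟩,
   ⟨(10, 11), 680647820734056377168102742755633070080, 680647820734056377168102743030510977024,
      .jump [(-1, -1), (1, -1)]⟩,
   ⟨(10, 11), 680647820740247135156244868655331934208, 680647820751388595657387278903473078272,
      .jump [(-1, -1), (1, 0), (-1, -1), (1, -1), (-1, -1)]⟩,
   ⟨(10, 11), 680647820734056377168102743030376710144, 680647820734056377168102743030410264576,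
      .jump [(-1, -1), (1, -1)]⟩,
   ⟨(10, 11), 680647820734056377168101053905772789760,
      34256734259870141891101786253174826613919178752,
      .place (3, 4)⟩,
   ⟨(10, 11), 680647820734211044105933653281472823296,
      34256734259870146804448165190443572803703660544,
      .place (5, 6)⟩,
   ⟨(10, 11), 680647830876654994896945917757505191936,
      34256734770501454995363253571689672878042636288,
      .place (7, 8)⟩,
   ⟨(10, 11), 20285041510728140214952701247488, 34256734770501454995363253571689672878042636288,
      .place (9, 10)⟩]

theorem table_ok : ∀ e ∈ table, e.ok table = true := by
  have : (table.all fun e => e.ok table) = true := by decide +kernel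
  exact List.all_eq_true.1 this

theorem replied_P0 : replied table (1, 2) P0mask fullMask = true := by decide +kernel

theorem encodes_P0chaps : Encodes P0mask fullMask P0chaps := by
  have h₁ : ∀ p ∈ P0chaps, has P0mask p = true := by decide +kernel
  have h₂ : ∀ p ∈ points, has P0mask p = true → p ∈ P0chaps := by decide +kernel
  intro p _
  refine ⟨h₁ p, fun hp => h₂ p (mem_points ?_) hp⟩
  simp only [has, Bool.and_eq_true] at hp
  exact hp.1

theorem held_P0 : Held table P0 := .inr (.inr ⟨rfl, _, _, encodes_P0chaps, replied_P0⟩)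

theorem held_P0_rot : Held table P0.rot := by
  have hball : rot (1, 2) = (10, 11) := by decide
  have hchaps : P0chaps.image rot = P0chaps := by decide +kernel
  refine .inr (.inl ⟨rfl, ⟨(10, 11), P0mask, fullMask, .place (9, 10)⟩, by simp [table], ?_, ?_⟩)
  · exact hball.symm
  · change Encodes P0mask fullMask (P0chaps.image rot)
    rw [hchaps]
    exact encodes_P0chaps

/-- **Theorem (Sarkar, Theorem 1).**  The position `P0` on the 12 × 10 Phutball
board (with Alfred to move) is drawn: both Alfred and Betty have drawing
strategies from `P0`. -/
theorem P0_drawn : Drawn 12 10 P0 :=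
  ⟨drawsFrom_true_of_rot_invariant (Held table) held_P0_rot (fun _ h => h.winner_ne table_ok)
      (fun _ h => h.exists_move table_ok) (fun _ _ h => h.of_move),
    drawsFrom_of_invariant (Held table) held_P0 (fun _ h => h.winner_ne table_ok)
      (fun _ h => h.exists_move table_ok) (fun _ _ h => h.of_move)⟩
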